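/- For every n ∈ ℕ_{+} and every x ∈ G, n·K_n^κ(x) = 1 + Σ_{i=0}^{|n|−1} 2^i D_{2^i}(x) + Σ_{i=0}^{|n|−1} 2^i r_i(x) K_{2^i}^w(τ_i(x)) + (n − 2^{|n|})·( D_{2^{|n|}}(x) + r_{|n|}(x) K_{n−2^{|n|}}^w(τ_{|n|}(x)) ). -/

import Mathlib

open MeasureTheory Filter
open scoped ENNReal

noncomputable section

namespace WalshKaczmarz

/-- The Walsh group `G`: sequences of elements of `ZMod 2` with coordinatewise
addition modulo 2. -/
abbrev G : Type := ℕ → ZMod 2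

instance : MeasurableSpace (ZMod 2) := ⊤

/-- The normalized Haar (product) measure on `G`, realized as the pushforward of
Lebesgue measure on `[0,1)` under the binary digit expansion map. Each coordinate
is uniformly distributed on `ZMod 2` and coordinates are independent.  -/
def μG : Measure G :=
  Measure.map (fun t : ℝ => fun k : ℕ => ((⌊t * 2 ^ (k + 1)⌋ : ℤ) : ZMod 2))
    (volume.restrict (Set.Ico (0 : ℝ) 1))

/-- The dyadic interval `I_n(x)`. -/
def I (n : ℕ) (x : G) : Set G := {y : G | ∀ k < n, y k = x k}

/-- `e n` : the element of `G` whose `n`-th coordinate is `1` and all others `0`. -/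
def e (n : ℕ) : G := fun k => if k = n then 1 else 0

/-- The `k`-th Rademacher function `r_k(x) = (-1)^{x_k}`. -/
def rademacher (k : ℕ) (x : G) : ℝ := (-1 : ℝ) ^ (x k).val

/-- `|n| = max {j : n_j ≠ 0}`, the order of `n ≥ 1`. -/
def order (n : ℕ) : ℕ := Nat.log 2 n

/-- The Walsh–Paley function `w_n = ∏_k r_k^{n_k}`. -/
def walsh (n : ℕ) (x : G) : ℝ :=
  ∏ k ∈ Finset.range n, (if n.testBit k then rademacher k x else 1)

/-- The Walsh–Kaczmarz function `κ_n`. -/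
def kacz (n : ℕ) (x : G) : ℝ :=
  if n = 0 then 1 else
    rademacher (order n) x *
      (-1 : ℝ) ^ (∑ k ∈ Finset.range (order n),
        (if n.testBit k then (x (order n - 1 - k)).val else 0))

/-- Skvortsov's coordinate transformation `τ_A`. -/
def tau (A : ℕ) (x : G) : G := fun k => if k < A then x (A - 1 - k) else x k

/-- The Walsh–Paley Dirichlet kernel `D_n^w`. -/
def dirW (n : ℕ) (x : G) : ℝ := ∑ k ∈ Finset.range n, walsh k x

/-- The Walsh–Kaczmarz Dirichlet kernel `D_n^κ`. -/
def dirK (n : ℕ) (x : G) : ℝ := ∑ k ∈ Finset.range n, kacz k x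

/-- The Walsh–Paley Fejér kernel `K_n^w = (1/n) ∑_{k=0}^n D_k^w`. -/
def fejW (n : ℕ) (x : G) : ℝ := (1 / (n : ℝ)) * ∑ k ∈ Finset.range (n + 1), dirW k x

/-- The Walsh–Kaczmarz Fejér kernel `K_n^κ = (1/n) ∑_{k=0}^n D_k^κ`. -/
def fejK (n : ℕ) (x : G) : ℝ := (1 / (n : ℝ)) * ∑ k ∈ Finset.range (n + 1), dirK k x

/-- The Walsh–Kaczmarz–Fourier coefficient of an integrable function. -/
def coeffK (f : G → ℝ) (k : ℕ) : ℝ := ∫ x, f x * kacz k x ∂μG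

/-- The `n`-th Walsh–Kaczmarz partial sum `S_n^κ f`. -/
def SK (f : G → ℝ) (n : ℕ) (x : G) : ℝ := ∑ k ∈ Finset.range n, coeffK f k * kacz k x

/-- The `n`-th Walsh–Kaczmarz Fejér mean `σ_n^κ f = (1/n) ∑_{j=0}^n S_j^κ f`. -/
def sigmaK (f : G → ℝ) (n : ℕ) (x : G) : ℝ :=
  (1 / (n : ℝ)) * ∑ j ∈ Finset.range (n + 1), SK f j x

/-- `𝔉_n` : the σ-algebra generated by the dyadic intervals of measure `2^{-n}`. -/
def F (n : ℕ) : MeasurableSpace G := MeasurableSpace.generateFrom {s | ∃ x : G, s = I n x}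

/-- A martingale with respect to the filtration `(𝔉_n)` of dyadic σ-algebras. -/
def IsDyadicMartingale (f : ℕ → G → ℝ) : Prop :=
  (∀ n, Integrable (f n) μG) ∧ (∀ n, StronglyMeasurable[F n] (f n)) ∧
    ∀ n, μG[f (n + 1)|F n] =ᵐ[μG] f n

/-- `‖f‖_{H_p}^p = ∫ (f^*)^p dμ` for a martingale `f`, where `f^* = sup_n |f^{(n)}|`
is the maximal function. -/
def martHpNormP (p : ℝ) (f : ℕ → G → ℝ) : ℝ≥0∞ :=
  ∫⁻ x, (⨆ n, ENNReal.ofReal |f n x|) ^ p ∂μG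

/-- The martingale Hardy norm `‖f‖_{H_p} = ‖f^*‖_{L_p}`. -/
def martHpNorm (p : ℝ) (f : ℕ → G → ℝ) : ℝ≥0∞ := martHpNormP p f ^ (1 / p)

/-- Membership in the martingale Hardy space `H_p(G)`. -/
def MemHp (p : ℝ) (f : ℕ → G → ℝ) : Prop :=
  IsDyadicMartingale f ∧ martHpNormP p f < ∞

/-- The maximal function of an integrable function `g`, i.e. of the martingale
`(S_{2^n} g)`:  `g^*(x) = sup_n (1/μ(I_n(x))) |∫_{I_n(x)} g dμ|`. -/
def funMaximal (g : G → ℝ) (x : G) : ℝ≥0∞ :=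
  ⨆ n : ℕ, ENNReal.ofReal |∫ u in I n x, g u ∂μG| / μG (I n x)

/-- `‖g‖_{H_p}^p` for a function `g`, identified with the martingale `(S_{2^n} g)`. -/
def funHpNormP (p : ℝ) (g : G → ℝ) : ℝ≥0∞ := ∫⁻ x, funMaximal g x ^ p ∂μG

/-- `‖g‖_{L_p}^p = ∫ |g|^p dμ`. -/
def funLpNormP (p : ℝ) (g : G → ℝ) : ℝ≥0∞ := ∫⁻ x, ENNReal.ofReal |g x| ^ p ∂μG

/-- The weak `L_p` quasinorm `‖g‖_{L_{p,∞}} = sup_{λ>0} λ μ({|g|>λ})^{1/p}`. -/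
def weakLpNorm (p : ℝ) (g : G → ℝ) : ℝ≥0∞ :=
  ⨆ (t : ℝ) (_ : 0 < t), ENNReal.ofReal t * μG {x : G | t < |g x|} ^ (1 / p)

/-- The Walsh–Kaczmarz–Fourier coefficient of a martingale:
`f̂(i) = lim_k ∫ f^{(k)} κ_i dμ`. -/
def martCoeffK (f : ℕ → G → ℝ) (i : ℕ) : ℝ :=
  limUnder atTop (fun k => ∫ x, f k x * kacz i x ∂μG)

/-- The `n`-th Walsh–Kaczmarz partial sum of a martingale. -/
def martSK (f : ℕ → G → ℝ) (n : ℕ) (x : G) : ℝ :=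
  ∑ k ∈ Finset.range n, martCoeffK f k * kacz k x

/-- The `n`-th Walsh–Kaczmarz Fejér mean of a martingale. -/
def martSigmaK (f : ℕ → G → ℝ) (n : ℕ) (x : G) : ℝ :=
  (1 / (n : ℝ)) * ∑ j ∈ Finset.range (n + 1), martSK f j x

/-- A `p`-atom supported on the dyadic interval `I_n(x₀)`. -/
def IsPAtomOn (p : ℝ) (n : ℕ) (x₀ : G) (a : G → ℝ) : Prop :=
  Measurable a ∧ (∀ y, y ∉ I n x₀ → a y = 0) ∧ (∫ y in I n x₀, a y ∂μG) = 0 ∧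
    ∀ y, ENNReal.ofReal |a y| ≤ μG (I n x₀) ^ (-(1 / p))

/-- A `p`-atom. -/
def IsPAtom (p : ℝ) (a : G → ℝ) : Prop := ∃ n x₀, IsPAtomOn p n x₀ a

end WalshKaczmarz
namespace WalshKaczmarz

/-- The product defining `walsh n` may be taken over any range covering the binary digits. -/
lemma walsh_eq_prod_range {n A : ℕ} (h : n < 2 ^ A) (x : G) :
    walsh n x = ∏ k ∈ Finset.range A, (if n.testBit k then rademacher k x else 1) := by
  have key : ∀ B C : ℕ, n < 2 ^ B → B ≤ C →
      ∏ k ∈ Finset.range B, (if n.testBit k then rademacher k x else 1) =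
        ∏ k ∈ Finset.range C, (if n.testBit k then rademacher k x else 1) := by
    intro B C hB hBC
    refine Finset.prod_subset (Finset.range_subset_range.2 hBC) fun k _ hk => ?_
    have hBk : B ≤ k := by simpa using hk
    rw [Nat.testBit_lt_two_pow (hB.trans_le (Nat.pow_le_pow_right two_pos hBk))]
    simp
  rw [walsh, key n (max n A) Nat.lt_two_pow_self (le_max_left _ _),
    key A (max n A) h (le_max_right _ _)]

lemma walsh_two_pow_add {A j : ℕ} (h : j < 2 ^ A) (x : G) :
    walsh (2 ^ A + j) x = rademacher A x * walsh j x := by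
  have hlt : 2 ^ A + j < 2 ^ (A + 1) := by rw [pow_succ]; omega
  rw [walsh_eq_prod_range hlt, walsh_eq_prod_range h, Finset.prod_range_succ, mul_comm,
    Nat.testBit_two_pow_add_eq, Nat.testBit_lt_two_pow h]
  simp only [Bool.not_false, if_true]
  congr 1
  refine Finset.prod_congr rfl fun k hk => ?_
  rw [Nat.testBit_two_pow_add_gt (Finset.mem_range.1 hk)]

lemma order_two_pow_add {A j : ℕ} (h : j < 2 ^ A) : order (2 ^ A + j) = A :=
  Nat.log_eq_of_pow_le_of_lt_pow (Nat.le_add_right _ _) (by rw [pow_succ]; omega)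

lemma kacz_two_pow_add {A j : ℕ} (h : j < 2 ^ A) (x : G) :
    kacz (2 ^ A + j) x = rademacher A x * walsh j (tau A x) := by
  have h0 : 2 ^ A + j ≠ 0 := by positivity
  rw [kacz, if_neg h0, order_two_pow_add h, walsh_eq_prod_range h, ← Finset.prod_pow_eq_pow_sum]
  congr 1
  refine Finset.prod_congr rfl fun k hk => ?_
  have hkA := Finset.mem_range.1 hk
  rw [Nat.testBit_two_pow_add_gt hkA]
  split_ifs <;> simp [rademacher, tau, hkA]

lemma dirW_two_pow_add {A j : ℕ} (h : j ≤ 2 ^ A) (x : G) :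
    dirW (2 ^ A + j) x = dirW (2 ^ A) x + rademacher A x * dirW j x := by
  simp only [dirW]
  rw [Finset.sum_range_add, Finset.mul_sum]
  congr 1
  exact Finset.sum_congr rfl fun k hk =>
    walsh_two_pow_add ((Finset.mem_range.1 hk).trans_le h) x

lemma dirK_two_pow_add {A j : ℕ} (h : j ≤ 2 ^ A) (x : G) :
    dirK (2 ^ A + j) x = dirK (2 ^ A) x + rademacher A x * dirW j (tau A x) := by
  simp only [dirK, dirW]
  rw [Finset.sum_range_add, Finset.mul_sum]
  congr 1
  exact Finset.sum_congr rfl fun k hk =>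
    kacz_two_pow_add ((Finset.mem_range.1 hk).trans_le h) x

lemma dirW_two_pow (A : ℕ) (x : G) :
    dirW (2 ^ A) x = ∏ i ∈ Finset.range A, (1 + rademacher i x) := by
  induction A with
  | zero => simp [dirW, walsh]
  | succ A ih =>
    rw [Finset.prod_range_succ, ← ih, pow_succ, mul_two, dirW_two_pow_add le_rfl]
    ring

lemma dirW_two_pow_tau (A : ℕ) (x : G) : dirW (2 ^ A) (tau A x) = dirW (2 ^ A) x := by
  rw [dirW_two_pow, dirW_two_pow, ← Finset.prod_range_reflect]
  refine Finset.prod_congr rfl fun k hk => ?_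
  have hk := Finset.mem_range.1 hk
  have hlt : A - 1 - k < A := by omega
  have heq : A - 1 - (A - 1 - k) = k := by omega
  simp [rademacher, tau, hlt, heq]

lemma dirK_two_pow (A : ℕ) (x : G) : dirK (2 ^ A) x = dirW (2 ^ A) x := by
  induction A with
  | zero => simp [dirK, dirW, walsh, kacz]
  | succ A ih =>
    rw [pow_succ, mul_two, dirK_two_pow_add le_rfl, dirW_two_pow_add le_rfl, ih,
      dirW_two_pow_tau]

lemma natCast_mul_fejW (n : ℕ) (x : G) :
    (n : ℝ) * fejW n x = ∑ k ∈ Finset.range n, dirW (k + 1) x := by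
  rw [fejW, Finset.sum_range_succ']
  rcases eq_or_ne n 0 with rfl | hn
  · simp
  · have : (n : ℝ) ≠ 0 := Nat.cast_ne_zero.2 hn
    field_simp
    simp [dirW]

lemma natCast_mul_fejK (n : ℕ) (x : G) :
    (n : ℝ) * fejK n x = ∑ k ∈ Finset.range n, dirK (k + 1) x := by
  rw [fejK, Finset.sum_range_succ']
  rcases eq_or_ne n 0 with rfl | hn
  · simp
  · have : (n : ℝ) ≠ 0 := Nat.cast_ne_zero.2 hn
    field_simp
    simp [dirK]

lemma sum_dirK_two_pow_add {A m : ℕ} (h : m ≤ 2 ^ A) (x : G) :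
    ∑ k ∈ Finset.range (2 ^ A + m), dirK (k + 1) x =
      ∑ k ∈ Finset.range (2 ^ A), dirK (k + 1) x
        + (m : ℝ) * (dirW (2 ^ A) x + rademacher A x * fejW m (tau A x)) := by
  have hterm : ∀ k ∈ Finset.range m, dirK (2 ^ A + k + 1) x =
      dirW (2 ^ A) x + rademacher A x * dirW (k + 1) (tau A x) := fun k hk => by
    have hk := Finset.mem_range.1 hk
    rw [add_assoc, dirK_two_pow_add (by omega), dirK_two_pow]
  rw [Finset.sum_range_add, Finset.sum_congr rfl hterm, Finset.sum_add_distrib,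
    ← Finset.mul_sum, ← natCast_mul_fejW]
  simp only [Finset.sum_const, Finset.card_range, nsmul_eq_mul]
  ring

lemma sum_dirK_two_pow (A : ℕ) (x : G) :
    ∑ k ∈ Finset.range (2 ^ A), dirK (k + 1) x =
      1 + (∑ i ∈ Finset.range A, (2 : ℝ) ^ i * dirW (2 ^ i) x)
        + ∑ i ∈ Finset.range A, (2 : ℝ) ^ i * rademacher i x * fejW (2 ^ i) (tau i x) := by
  induction A with
  | zero => simp [dirK, kacz]
  | succ A ih =>
    rw [pow_succ, mul_two, sum_dirK_two_pow_add le_rfl, ih, Finset.sum_range_succ,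
      Finset.sum_range_succ]
    push_cast
    ring

/-- Skvortsov's decomposition of the Walsh–Kaczmarz Fejér kernel: for `n ≥ 1`,
`n K_n^κ(x) = 1 + ∑_{i<|n|} 2^i D_{2^i}(x) + ∑_{i<|n|} 2^i r_i(x) K_{2^i}^w(τ_i(x))
 + (n - 2^{|n|})(D_{2^{|n|}}(x) + r_{|n|}(x) K_{n-2^{|n|}}^w(τ_{|n|}(x)))`. -/
theorem skvortsov_kernel_decomposition (n : ℕ) (hn : 1 ≤ n) (x : G) :
    (n : ℝ) * fejK n x =
      1 + (∑ i ∈ Finset.range (order n), (2 : ℝ) ^ i * dirW (2 ^ i) x)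
        + (∑ i ∈ Finset.range (order n),
            (2 : ℝ) ^ i * rademacher i x * fejW (2 ^ i) (tau i x))
        + ((n - 2 ^ order n : ℕ) : ℝ) *
            (dirW (2 ^ order n) x
              + rademacher (order n) x * fejW (n - 2 ^ order n) (tau (order n) x)) := by
  have hle : 2 ^ order n ≤ n := Nat.pow_log_le_self 2 (by omega)
  have hlt : n < 2 ^ (order n + 1) := Nat.lt_pow_succ_log_self one_lt_two n
  rw [pow_succ] at hlt
  rw [natCast_mul_fejK, ← sum_dirK_two_pow, ← sum_dirK_two_pow_add (by omega),
    Nat.add_sub_cancel' hle]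

end WalshKaczmarz
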